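/- Let $p$ be an odd prime, $f : \mathbb{Z}_p \to \mathbb{Q}_p$ a continuous function, $n \geq 0$ an integer, and suppose the sequence $N \mapsto \sum_{x=0}^{p^N - 1} (-1)^x f(x)$ converges to $L \in \mathbb{Q}_p$ as $N \to \infty$. Then the sequence $N \mapsto \sum_{x=0}^{p^N - 1} (-1)^x f(x+n)$ converges to $(-1)^n L + 2 \sum_{l=0}^{n-1} (-1)^{n-1-l} f(l)$. -/

import Mathlib

open Filter

/-- The powers `p ^ N` tend to `0` in `ℤ_p`. -/
theorem PadicInt.tendsto_natCast_prime_pow (p : ℕ) [Fact p.Prime] :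
    Tendsto (fun N : ℕ => ((p ^ N : ℕ) : ℤ_[p])) atTop (nhds 0) := by
  simp only [Nat.cast_pow]
  refine tendsto_pow_atTop_nhds_zero_of_norm_lt_one ?_
  rw [PadicInt.norm_p]
  exact inv_lt_one_of_one_lt₀ (mod_cast (Fact.out : p.Prime).one_lt)

/-- Shifting the argument by one in an alternating sum with an odd number of terms. -/
theorem sum_range_alternating_succ {R : Type*} [CommRing R] {M : ℕ} (hM : Odd M) (g : ℕ → R) :
    ∑ x ∈ Finset.range M, (-1 : R) ^ x * g (x + 1) =
      -(∑ x ∈ Finset.range M, (-1 : R) ^ x * g x) + (g M + g 0) := by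
  have h := Finset.sum_range_succ' (fun x => (-1 : R) ^ x * g x) M
  rw [Finset.sum_range_succ] at h
  simp only [hM.neg_one_pow, pow_succ, mul_neg, neg_mul, mul_one, one_mul, pow_zero,
    Finset.sum_neg_distrib] at h
  linear_combination h

/-- Extending an alternating sum, counted from its last term, by one more term. -/
theorem sum_range_succ_alternating_sub {R : Type*} [CommRing R] (g : ℕ → R) (n : ℕ) :
    ∑ l ∈ Finset.range (n + 1), (-1 : R) ^ (n - l) * g l =
      -(∑ l ∈ Finset.range n, (-1 : R) ^ (n - 1 - l) * g l) + g n := by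
  rw [Finset.sum_range_succ, Nat.sub_self, pow_zero, one_mul, ← Finset.sum_neg_distrib]
  congr 1
  refine Finset.sum_congr rfl fun l hl => ?_
  have hl' := Finset.mem_range.mp hl
  rw [show n - l = n - 1 - l + 1 by omega, pow_succ]
  ring

/-- Equation (3): for an odd prime `p`, a continuous `f : ℤ_p → ℚ_p` and `n ∈ ℕ`, if the
fermionic sums `∑_{x=0}^{p^N - 1} (-1)^x f(x)` converge to `L = I_1(f)` as `N → ∞`, then the
sums `∑_{x=0}^{p^N - 1} (-1)^x f(x+n)` converge to
`I_1(f_n) = (-1)^n I_1(f) + 2 ∑_{l=0}^{n-1} (-1)^{n-1-l} f(l)`. -/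
theorem fermionic_integral_shift (p : ℕ) [Fact p.Prime] (hp : Odd p)
    (f : ℤ_[p] → ℚ_[p]) (hf : Continuous f) (n : ℕ) (L : ℚ_[p])
    (hL : Tendsto (fun N : ℕ => ∑ x ∈ Finset.range (p ^ N), (-1 : ℚ_[p]) ^ x * f (x : ℕ))
      atTop (nhds L)) :
    Tendsto (fun N : ℕ =>
        ∑ x ∈ Finset.range (p ^ N), (-1 : ℚ_[p]) ^ x * f (((x + n : ℕ) : ℤ_[p])))
      atTop
      (nhds ((-1 : ℚ_[p]) ^ n * L +
        2 * ∑ l ∈ Finset.range n, (-1 : ℚ_[p]) ^ (n - 1 - l) * f (l : ℕ))) := by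
  induction n with
  | zero => simpa using hL
  | succ n ih =>
    have hlim : Tendsto (fun N : ℕ => f ((p ^ N + n : ℕ) : ℤ_[p])) atTop (nhds (f (n : ℕ))) := by
      refine (hf.tendsto _).comp ?_
      simpa using (PadicInt.tendsto_natCast_prime_pow p).add_const (n : ℤ_[p])
    have key := ih.neg.add (hlim.add_const (f (n : ℕ)))
    convert key using 1
    · funext N
      have h := sum_range_alternating_succ (hp.pow (n := N))
        (fun x => f ((x + n : ℕ) : ℤ_[p]))
      simp only [Nat.zero_add] at h
      rw [← h]
      refine Finset.sum_congr rfl fun x _ => ?_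
      rw [Nat.add_right_comm x 1 n, Nat.add_assoc x n 1]
    · rw [Nat.add_sub_cancel, sum_range_succ_alternating_sub (fun l => f (l : ℤ_[p])) n]
      ring_nf
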